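/- Let T be a tree, i.e. a connected simple graph with no cycles, with vertex set 𝒱 and set of oriented edges (darts) E⃗; for an oriented edge e = (v₁, v₂), write ē = (v₂, v₁) for its reversal. Let M be an abelian group, let C⁰(M) be the group of all functions 𝒱 → M, let C¹(M) be the group of functions f : E⃗ → M satisfying f(ē) = −f(e) for all e, and define δ : C⁰(M) → C¹(M) by δ(f)(e) = f(v₁) − f(v₂) for e = (v₁, v₂). Then the sequence 0 → M → C⁰(M) →^δ C¹(M) → 0 is exact: (i) a function f ∈ C⁰(M) satisfies δ(f) = 0 if and only if f is constant, and (ii) every g ∈ C¹(M) equals δ(f) for some f ∈ C⁰(M). -/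

import Mathlib

/-- In an acyclic graph, the sum of an odd function of the darts along paths to a fixed vertex
changes by the value of the function at a dart when the starting point moves along that dart. -/
lemma SimpleGraph.IsAcyclic.sum_darts_sub_sum_darts {V M : Type*} [AddCommGroup M]
    {G : SimpleGraph V} (hG : G.IsAcyclic) {g : G.Dart → M} (hg : ∀ e, g e.symm = -g e)
    {u v r : V} (h : G.Adj u v) {p : G.Walk u r} {q : G.Walk v r}
    (hp : p.IsPath) (hq : q.IsPath) :
    (p.darts.map g).sum - (q.darts.map g).sum = g ⟨(u, v), h⟩ := by
  by_cases hu : u ∈ q.support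
  · have hv : v ∉ p.support := fun hv =>
      hG.ne_mem_support_of_support_of_adj_of_isPath hq.reverse hp.reverse h.symm
        (by simpa using hu) (by simpa using hv)
    have hqp : q = .cons h.symm p :=
      congrArg Subtype.val ((hG.subsingleton_path v r).elim ⟨q, hq⟩ ⟨_, hp.cons hv⟩)
    have hsymm : g ⟨(v, u), h.symm⟩ = -g ⟨(u, v), h⟩ := hg ⟨(u, v), h⟩
    simp [hqp, hsymm]
  · have hpq : p = .cons h q :=
      congrArg Subtype.val ((hG.subsingleton_path u r).elim ⟨p, hp⟩ ⟨_, hq.cons hu⟩)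
    simp [hpq]

/-- Let `T` be a tree with vertex set `𝒱` and darts (oriented edges) `E⃗`, and `M` an abelian
group. With `C⁰(M)` the functions `𝒱 → M`, `C¹(M)` the functions `f : E⃗ → M` with
`f(ē) = −f(e)`, and `δ(f)(e) = f(v₁) − f(v₂)` for `e = (v₁,v₂)`, the sequence
`0 → M → C⁰(M) → C¹(M) → 0` is exact: (i) `δ(f) = 0` iff `f` is constant, and
(ii) every `g ∈ C¹(M)` is of the form `δ(f)`. -/
theorem stmt7 {V : Type*} (G : SimpleGraph V) (hG : G.IsTree)
    (M : Type*) [AddCommGroup M] :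
    (∀ f : V → M,
      (∀ e : G.Dart, f e.toProd.1 - f e.toProd.2 = 0) ↔ ∃ m : M, ∀ v : V, f v = m) ∧
    (∀ g : G.Dart → M, (∀ e : G.Dart, g e.symm = -g e) →
      ∃ f : V → M, ∀ e : G.Dart, g e = f e.toProd.1 - f e.toProd.2) := by
  constructor
  · intro f
    constructor
    · intro hf
      obtain ⟨r⟩ := hG.connected.nonempty
      refine ⟨f r, fun v => ?_⟩
      obtain ⟨p⟩ := hG.connected.preconnected v r
      induction p with
      | nil => rfl
      | cons h _ ih => exact (sub_eq_zero.mp (hf ⟨(_, _), h⟩)).trans ih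
    · rintro ⟨m, hm⟩ e
      simp [hm]
  · intro g hg
    obtain ⟨r⟩ := hG.connected.nonempty
    choose p hp _ using fun v => hG.existsUnique_path v r
    exact ⟨fun v => ((p v).darts.map g).sum, fun e =>
      (hG.isAcyclic.sum_darts_sub_sum_darts hg e.adj (hp _) (hp _)).symm⟩
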